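/- Let H be a tree with a distinguished vertex u, let T_r be a tree on r ≥ 1 vertices disjoint from H with a distinguished vertex v, let G_1 be the tree obtained from the disjoint union of H and T_r by adding the edge uv, and let G_2 be the tree obtained from H by attaching r pendant edges at u. Label the edges of T_r together with uv as e'_1 = uv, e'_2, …, e'_r, label the r pendant edges at u in G_2 as e_1, …, e_r, and for an edge e let d(e) denote the product of the degrees (in the ambient graph G_1, respectively G_2) of its two endpoints. Set ψ = Σ_{i=1}^r 1/d(e'_i) and θ = Σ_{i=1}^r 1/d(e_i). If ψ ≥ θ, then π(G_1) ≥ π(G_2). -/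

import Mathlib

open scoped Classical

/-- Permanent of the Laplacian matrix of `G` (over `ℝ`). -/
noncomputable def permL {V : Type*} [Fintype V] (G : SimpleGraph V) : ℝ :=
  (G.lapMatrix ℝ).permanent

/-- Product of the degrees of all vertices of `G`. -/
noncomputable def PD {V : Type*} [Fintype V] (G : SimpleGraph V) : ℝ :=
  ∏ v, (G.degree v : ℝ)

/-- The Laplacian ratio `π(G) = per L(G) / PD(G)`. -/
noncomputable def lapRatio {V : Type*} [Fintype V] (G : SimpleGraph V) : ℝ :=
  permL G / PD G

/-- The product of the degrees of the two endpoints of an edge `e`. -/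
noncomputable def edgeDeg {V : Type*} [Fintype V] (G : SimpleGraph V) (e : Sym2 V) : ℝ :=
  Sym2.lift ⟨fun a b => (G.degree a : ℝ) * (G.degree b : ℝ), fun _ _ => mul_comm _ _⟩ e

/-- `G₁`: the tree obtained from the disjoint union of `H` and `T` by adding the edge
joining `u ∈ V(H)` to `v ∈ V(T)`. -/
def joinTrees {α β : Type*} (H : SimpleGraph α) (T : SimpleGraph β) (u : α) (v : β) :
    SimpleGraph (α ⊕ β) :=
  (H ⊕g T) ⊔ SimpleGraph.fromEdgeSet {s(Sum.inl u, Sum.inr v)}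

/-- `G₂`: the tree obtained from `H` by attaching a pendant edge at `u` for every `b : β`. -/
def attachPendants {α : Type*} (β : Type*) (H : SimpleGraph α) (u : α) :
    SimpleGraph (α ⊕ β) :=
  (H ⊕g (⊥ : SimpleGraph β)) ⊔
    SimpleGraph.fromEdgeSet {e | ∃ b : β, e = s(Sum.inl u, Sum.inr b)}

lemma SimpleGraph.IsTree.exists_sign {V : Type*} {G : SimpleGraph V} (hG : G.IsTree) :
    ∃ s : V → ℝ, (∀ v, s v * s v = 1) ∧ ∀ v w, G.Adj v w → s v * s w = -1 := by
  obtain ⟨c⟩ := hG.isBipartite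
  refine ⟨fun v => if c v = 0 then 1 else -1, fun v => by dsimp; split_ifs <;> norm_num, ?_⟩
  intro v w h
  have hc := c.valid h
  dsimp
  split_ifs with h₁ h₂ h₂
  · exact absurd (h₁.trans h₂.symm) hc
  · norm_num
  · norm_num
  · exact absurd (by omega) hc

lemma SimpleGraph.IsTree.exists_adj {V : Type*} {G : SimpleGraph V} (hG : G.IsTree) {v w : V}
    (h : v ≠ w) : ∃ x, G.Adj v x := by
  have : Nontrivial V := ⟨v, w, h⟩
  exact hG.connected.preconnected.exists_adj_of_nontrivial v

/-- Absolute value of the entry at `(w, v)` of the Laplacian matrix of `G` with column `v`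
divided by the degree of `v`. -/
noncomputable def normWeight {V : Type*} [Fintype V] (G : SimpleGraph V) (w v : V) : ℝ :=
  if w = v then 1 else if G.Adj w v then (G.degree v : ℝ)⁻¹ else 0

/-- The contribution of a permutation to the permanent of the matrix `normWeight G`. -/
noncomputable def permWeight {V : Type*} [Fintype V] (G : SimpleGraph V) (σ : Equiv.Perm V) : ℝ :=
  ∏ x, normWeight G (σ x) x

section General

variable {V : Type*} [Fintype V] {G : SimpleGraph V}

@[simp]
lemma normWeight_self (v : V) : normWeight G v v = 1 := if_pos rfl

lemma normWeight_nonneg (w v : V) : 0 ≤ normWeight G w v := by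
  unfold normWeight
  split_ifs <;> positivity

lemma normWeight_of_adj {w v : V} (h : G.Adj w v) : normWeight G w v = (G.degree v : ℝ)⁻¹ := by
  rw [normWeight, if_neg h.ne, if_pos h]

lemma permWeight_nonneg (σ : Equiv.Perm V) : 0 ≤ permWeight G σ :=
  Finset.prod_nonneg fun _ _ => normWeight_nonneg _ _

/-- A permutation of nonzero weight moves every vertex to itself or to a neighbour. -/
lemma adj_of_permWeight_ne_zero {σ : Equiv.Perm V} (h : permWeight G σ ≠ 0) {v : V}
    (hv : σ v ≠ v) : G.Adj (σ v) v := by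
  by_contra hadj
  refine h (Finset.prod_eq_zero (Finset.mem_univ v) ?_)
  rw [normWeight, if_neg hv, if_neg hadj]

/-- For a bipartite graph without isolated vertices, all the terms of the Laplacian ratio are
nonnegative. -/
lemma lapRatio_eq_sum_permWeight (hdeg : ∀ v, 0 < G.degree v) {s : V → ℝ}
    (hs : ∀ v, s v * s v = 1) (hadj : ∀ v w, G.Adj v w → s v * s w = -1) :
    lapRatio G = ∑ σ : Equiv.Perm V, permWeight G σ := by
  have entry (w v : V) :
      G.lapMatrix ℝ w v = (s w * s v) * (G.degree v : ℝ) * normWeight G w v := by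
    have hv : (G.degree v : ℝ) ≠ 0 := by exact_mod_cast (hdeg v).ne'
    by_cases h : w = v
    · subst h
      simp [SimpleGraph.lapMatrix, SimpleGraph.degMatrix, hs]
    · by_cases ha : G.Adj w v
      · simp [SimpleGraph.lapMatrix, SimpleGraph.degMatrix, normWeight, h, ha, hadj w v ha, hv]
      · simp [SimpleGraph.lapMatrix, SimpleGraph.degMatrix, normWeight, h, ha]
  have hPD : PD G ≠ 0 :=
    Finset.prod_ne_zero_iff.mpr fun v _ => by exact_mod_cast (hdeg v).ne'
  have hsigns (σ : Equiv.Perm V) : ∏ v, s (σ v) * s v = 1 := by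
    rw [Finset.prod_mul_distrib, Equiv.prod_comp σ s, ← Finset.prod_mul_distrib]
    exact Finset.prod_eq_one fun v _ => hs v
  rw [lapRatio, div_eq_iff hPD, Finset.sum_mul, permL, Matrix.permanent]
  refine Finset.sum_congr rfl fun σ _ => ?_
  simp only [entry, Finset.prod_mul_distrib (g := fun v => normWeight G (σ v) v)]
  rw [Finset.prod_mul_distrib, hsigns, one_mul, mul_comm]
  rfl

/-- Composing with the transposition of two adjacent fixed points divides the weight by the
product of their degrees. -/
lemma permWeight_mul_swap [DecidableEq V] {σ : Equiv.Perm V} {x y : V} (hx : σ x = x)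
    (hy : σ y = y) (h : G.Adj x y) :
    permWeight G (σ * Equiv.swap x y) = permWeight G σ * (edgeDeg G s(x, y))⁻¹ := by
  have key (z : V) : normWeight G ((σ * Equiv.swap x y) z) z =
      normWeight G (σ z) z * ((if z = x then (G.degree x : ℝ)⁻¹ else 1) *
        (if z = y then (G.degree y : ℝ)⁻¹ else 1)) := by
    by_cases hzx : z = x
    · subst hzx
      simp [hx, hy, h.ne, normWeight_of_adj h.symm]
    · by_cases hzy : z = y
      · subst hzy
        simp [hx, hy, hzx, normWeight_of_adj h]
      · simp [hzx, hzy, Equiv.swap_apply_of_ne_of_ne hzx hzy]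
  unfold permWeight
  simp only [key]
  rw [Finset.prod_mul_distrib, Finset.prod_mul_distrib]
  simp [edgeDeg, mul_comm]

lemma edgeDeg_nonneg (e : Sym2 V) : 0 ≤ edgeDeg G e := by
  induction e with
  | _ x y => exact mul_nonneg (Nat.cast_nonneg _) (Nat.cast_nonneg _)

end General

section Sum

variable {α β ι : Type*}

/-- The permutations of `α ⊕ β` acting as a permutation of `α`, possibly composed with the
transposition of one of the pairs `inr (b i)`, `y i`; in the latter case `u` is fixed. -/
noncomputable def extendPerm (u : α) (b : ι → β) (y : ι → α ⊕ β) :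
    Equiv.Perm α ⊕ ({τ : Equiv.Perm α // τ u = u} × ι) → Equiv.Perm (α ⊕ β)
  | .inl τ => Equiv.Perm.sumCongr τ 1
  | .inr (τ, i) => Equiv.Perm.sumCongr τ.1 1 * Equiv.swap (Sum.inr (b i)) (y i)

variable {u : α} {b : ι → β} {y : ι → α ⊕ β}

lemma sumCongr_one_apply_eq_self {τ : Equiv.Perm α} (hτ : τ u = u) {z : α ⊕ β}
    (hz : z = Sum.inl u ∨ ∃ c, z = Sum.inr c) :
    Equiv.Perm.sumCongr τ (1 : Equiv.Perm β) z = z := by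
  obtain rfl | ⟨c, rfl⟩ := hz <;> simp [hτ]

lemma sumCongr_one_injective :
    Function.Injective fun τ : Equiv.Perm α => Equiv.Perm.sumCongr τ (1 : Equiv.Perm β) := by
  intro τ τ' h
  ext a
  simpa using congrArg (fun σ : Equiv.Perm (α ⊕ β) => σ (Sum.inl a)) h

lemma extendPerm_injective (hy : ∀ i, y i = Sum.inl u ∨ ∃ c, y i = Sum.inr c)
    (hne : ∀ i, Sum.inr (b i) ≠ y i)
    (hinj : Function.Injective fun i => s(Sum.inr (b i), y i)) :
    Function.Injective (extendPerm u b y) := by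
  have moved (τ : {τ : Equiv.Perm α // τ u = u}) (i : ι) :
      extendPerm u b y (.inr (τ, i)) (Sum.inr (b i)) = y i := by
    simp only [extendPerm, Equiv.Perm.mul_apply, Equiv.swap_apply_left]
    exact sumCongr_one_apply_eq_self τ.2 (hy i)
  have ne (τ' : Equiv.Perm α) (τ : {τ : Equiv.Perm α // τ u = u}) (i : ι) :
      extendPerm u b y (.inl τ') ≠ extendPerm u b y (.inr (τ, i)) := by
    intro h
    have h := congrArg (fun σ : Equiv.Perm (α ⊕ β) => σ (Sum.inr (b i))) h
    rw [moved] at h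
    exact hne i (by simpa [extendPerm] using h)
  rintro (τ | ⟨τ, i⟩) (τ' | ⟨τ', j⟩) h
  · exact congrArg _ (sumCongr_one_injective h)
  · exact absurd h (ne _ _ _)
  · exact absurd h.symm (ne _ _ _)
  · have hij : i = j := by
      refine hinj ?_
      have h' := congrArg (fun σ : Equiv.Perm (α ⊕ β) => σ (Sum.inr (b i))) h
      rw [moved] at h'
      simp only [extendPerm, Equiv.Perm.mul_apply] at h'
      by_cases h₁ : Sum.inr (b i) = (Sum.inr (b j) : α ⊕ β)
      · rw [h₁, Equiv.swap_apply_left, sumCongr_one_apply_eq_self τ'.2 (hy j)] at h'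
        dsimp only
        rw [h₁, h']
      · by_cases h₂ : Sum.inr (b i) = y j
        · rw [h₂, Equiv.swap_apply_right,
            sumCongr_one_apply_eq_self τ'.2 (Or.inr ⟨_, rfl⟩)] at h'
          dsimp only
          rw [h₂, h', Sym2.eq_swap]
        · rw [Equiv.swap_apply_of_ne_of_ne h₁ h₂] at h'
          exact absurd (by simpa using h'.symm) (hne i)
    subst hij
    have := sumCongr_one_injective (mul_right_cancel h)
    rw [Subtype.ext this]

variable [Fintype α] [Fintype β] [Fintype ι] {G : SimpleGraph (α ⊕ β)}

lemma sum_permWeight_extendPerm (hy : ∀ i, y i = Sum.inl u ∨ ∃ c, y i = Sum.inr c)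
    (hadj : ∀ i, G.Adj (Sum.inr (b i)) (y i)) :
    ∑ j, permWeight G (extendPerm u b y j) =
      ∑ τ : Equiv.Perm α, permWeight G (Equiv.Perm.sumCongr τ 1) +
        (∑ τ : {τ : Equiv.Perm α // τ u = u}, permWeight G (Equiv.Perm.sumCongr τ.1 1)) *
          ∑ i, (edgeDeg G s(Sum.inr (b i), y i))⁻¹ := by
  rw [Fintype.sum_sum_type, Fintype.sum_prod_type, Finset.sum_mul_sum]
  refine congrArg₂ _ rfl (Finset.sum_congr rfl fun τ _ => Finset.sum_congr rfl fun i _ => ?_)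
  exact permWeight_mul_swap (by simp) (sumCongr_one_apply_eq_self τ.2 (hy i)) (hadj i)

lemma permWeight_sumCongr_one (τ : Equiv.Perm α) :
    permWeight G (Equiv.Perm.sumCongr τ 1) =
      ∏ a, normWeight G (Sum.inl (τ a)) (Sum.inl a) := by
  simp [permWeight, Fintype.prod_sum_type]

end Sum

section Trees

variable {α β : Type*} {H : SimpleGraph α} {T : SimpleGraph β} {u : α} {v : β}

@[simp]
lemma joinTrees_adj_inl_inl {a a' : α} :
    (joinTrees H T u v).Adj (Sum.inl a) (Sum.inl a') ↔ H.Adj a a' := by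
  simp [joinTrees]

@[simp]
lemma joinTrees_adj_inr_inr {b b' : β} :
    (joinTrees H T u v).Adj (Sum.inr b) (Sum.inr b') ↔ T.Adj b b' := by
  simp [joinTrees]

@[simp]
lemma joinTrees_adj_inl_inr {a : α} {b : β} :
    (joinTrees H T u v).Adj (Sum.inl a) (Sum.inr b) ↔ a = u ∧ b = v := by
  simp [joinTrees]

@[simp]
lemma joinTrees_adj_inr_inl {a : α} {b : β} :
    (joinTrees H T u v).Adj (Sum.inr b) (Sum.inl a) ↔ a = u ∧ b = v := by
  rw [SimpleGraph.adj_comm, joinTrees_adj_inl_inr]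

@[simp]
lemma attachPendants_adj_inl_inl {a a' : α} :
    (attachPendants β H u).Adj (Sum.inl a) (Sum.inl a') ↔ H.Adj a a' := by
  simp [attachPendants]

@[simp]
lemma attachPendants_adj_inr_inr {b b' : β} :
    ¬ (attachPendants β H u).Adj (Sum.inr b) (Sum.inr b') := by
  simp [attachPendants]

@[simp]
lemma attachPendants_adj_inl_inr {a : α} {b : β} :
    (attachPendants β H u).Adj (Sum.inl a) (Sum.inr b) ↔ a = u := by
  simp [attachPendants]

@[simp]
lemma attachPendants_adj_inr_inl {a : α} {b : β} :
    (attachPendants β H u).Adj (Sum.inr b) (Sum.inl a) ↔ a = u := by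
  rw [SimpleGraph.adj_comm, attachPendants_adj_inl_inr]

variable [Fintype α] [Fintype β]

lemma joinTrees_degree_pos (hH : H.IsTree) (hT : T.IsTree) (x : α ⊕ β) :
    0 < (joinTrees H T u v).degree x := by
  rw [SimpleGraph.degree_pos_iff_exists_adj]
  obtain a | b := x
  · by_cases h : a = u
    · exact ⟨Sum.inr v, by simp [h]⟩
    · obtain ⟨a', ha'⟩ := hH.exists_adj h
      exact ⟨Sum.inl a', by simpa⟩
  · by_cases h : b = v
    · exact ⟨Sum.inl u, by simp [h]⟩
    · obtain ⟨b', hb'⟩ := hT.exists_adj h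
      exact ⟨Sum.inr b', by simpa⟩

lemma attachPendants_degree_pos [Nonempty β] (hH : H.IsTree) (x : α ⊕ β) :
    0 < (attachPendants β H u).degree x := by
  rw [SimpleGraph.degree_pos_iff_exists_adj]
  obtain a | b := x
  · by_cases h : a = u
    · exact ⟨Sum.inr (Classical.arbitrary β), by simp [h]⟩
    · obtain ⟨a', ha'⟩ := hH.exists_adj h
      exact ⟨Sum.inl a', by simpa⟩
  · exact ⟨Sum.inl u, by simp⟩

lemma lapRatio_joinTrees_eq_sum (hH : H.IsTree) (hT : T.IsTree) :
    lapRatio (joinTrees H T u v) =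
      ∑ σ : Equiv.Perm (α ⊕ β), permWeight (joinTrees H T u v) σ := by
  obtain ⟨s, hs, hs'⟩ := hH.exists_sign
  obtain ⟨t, ht, ht'⟩ := hT.exists_sign
  have sum_eq := lapRatio_eq_sum_permWeight (joinTrees_degree_pos (u := u) (v := v) hH hT)
    (s := Sum.elim s fun b => -(s u * t v) * t b) ?_ ?_
  · convert sum_eq
  · rintro (a | b)
    · exact hs a
    · simp only [Sum.elim_inr]
      linear_combination (t v * t v * t b * t b) * hs u + (t b * t b) * ht v + ht b
  · rintro (a | b) (a' | b') h
    · exact hs' a a' (by simpa using h)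
    · obtain ⟨rfl, rfl⟩ := joinTrees_adj_inl_inr.mp h
      simp only [Sum.elim_inl, Sum.elim_inr]
      linear_combination (-(t b' * t b')) * hs a - ht b'
    · obtain ⟨rfl, rfl⟩ := joinTrees_adj_inr_inl.mp h
      simp only [Sum.elim_inl, Sum.elim_inr]
      linear_combination (-(t b * t b)) * hs a' - ht b
    · have h' := ht' b b' (by simpa using h)
      simp only [Sum.elim_inr]
      linear_combination (t v * t v * t b * t b') * hs u + (t b * t b') * ht v + h'

lemma lapRatio_attachPendants_eq_sum [Nonempty β] (hH : H.IsTree) :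
    lapRatio (attachPendants β H u) =
      ∑ σ : Equiv.Perm (α ⊕ β), permWeight (attachPendants β H u) σ := by
  obtain ⟨s, hs, hs'⟩ := hH.exists_sign
  have sum_eq := lapRatio_eq_sum_permWeight (attachPendants_degree_pos (u := u) (β := β) hH)
    (s := Sum.elim s fun _ => -s u) ?_ ?_
  · convert sum_eq
  · rintro (a | b)
    · exact hs a
    · simpa using hs u
  · rintro (a | b) (a' | b') h
    · exact hs' a a' (by simpa using h)
    · obtain rfl := attachPendants_adj_inl_inr.mp h
      simpa using hs a
    · obtain rfl := attachPendants_adj_inr_inl.mp h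
      simpa using hs a'
    · exact absurd h attachPendants_adj_inr_inr

lemma degree_attachPendants_eq_degree_joinTrees {a : α} (ha : a ≠ u) :
    (attachPendants β H u).degree (Sum.inl a) = (joinTrees H T u v).degree (Sum.inl a) := by
  simp only [← SimpleGraph.card_neighborFinset_eq_degree]
  congr 1
  ext (c | c) <;> simp [ha]

lemma degree_joinTrees_le_degree_attachPendants :
    (joinTrees H T u v).degree (Sum.inl u) ≤ (attachPendants β H u).degree (Sum.inl u) := by
  simp only [← SimpleGraph.card_neighborFinset_eq_degree]
  refine Finset.card_le_card fun x hx => ?_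
  rw [SimpleGraph.mem_neighborFinset] at hx ⊢
  obtain c | c := x <;> simp_all

lemma normWeight_attachPendants_le (hH : H.IsTree) (hT : T.IsTree) (a a' : α) :
    normWeight (attachPendants β H u) (Sum.inl a') (Sum.inl a) ≤
      normWeight (joinTrees H T u v) (Sum.inl a') (Sum.inl a) := by
  by_cases ha : a = u
  · subst ha
    simp only [normWeight, joinTrees_adj_inl_inl, attachPendants_adj_inl_inl]
    split_ifs
    · exact le_rfl
    · have := joinTrees_degree_pos (u := a) (v := v) hH hT (Sum.inl a)
      have := degree_joinTrees_le_degree_attachPendants (H := H) (T := T) (u := a) (v := v)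
      gcongr
    · exact le_rfl
  · simp only [normWeight, joinTrees_adj_inl_inl, attachPendants_adj_inl_inl,
      degree_attachPendants_eq_degree_joinTrees (T := T) (v := v) ha]
    exact le_rfl

lemma permWeight_attachPendants_le (hH : H.IsTree) (hT : T.IsTree) (τ : Equiv.Perm α) :
    permWeight (attachPendants β H u) (Equiv.Perm.sumCongr τ 1) ≤
      permWeight (joinTrees H T u v) (Equiv.Perm.sumCongr τ 1) := by
  simp only [permWeight_sumCongr_one]
  exact Finset.prod_le_prod (fun _ _ => normWeight_nonneg _ _)
    fun _ _ => normWeight_attachPendants_le hH hT _ _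

/-- A permutation of nonzero weight in `attachPendants` uses at most one of the pendant edges. -/
lemma mem_range_extendPerm_of_permWeight_ne_zero {σ : Equiv.Perm (α ⊕ β)}
    (hσ : permWeight (attachPendants β H u) σ ≠ 0) :
    σ ∈ Set.range (extendPerm u (id : β → β) fun _ => Sum.inl u) := by
  have lift {ρ : Equiv.Perm (α ⊕ β)} (h : ∀ b, ρ (Sum.inr b) = Sum.inr b) :
      ∃ τ : Equiv.Perm α, Equiv.Perm.sumCongr τ 1 = ρ := by
    have hmaps : Set.MapsTo ρ (Set.range Sum.inl) (Set.range Sum.inl) := by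
      rintro _ ⟨a, rfl⟩
      rcases hc : ρ (Sum.inl a) with c | c
      · exact ⟨c, rfl⟩
      · exact absurd (ρ.injective (hc.trans (h c).symm)) (by simp)
    obtain ⟨⟨τ, τ'⟩, rfl⟩ := Equiv.Perm.mem_sumCongrHom_range_of_perm_mapsTo_inl hmaps
    refine ⟨τ, ?_⟩
    have : τ' = 1 := by
      ext b
      simpa using h b
    simp [this]
  by_cases hfix : ∀ b, σ (Sum.inr b) = Sum.inr b
  · obtain ⟨τ, hτ⟩ := lift hfix
    exact ⟨Sum.inl τ, hτ⟩
  · obtain ⟨b, hb⟩ := not_forall.mp hfix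
    have image {c : β} (hc : σ (Sum.inr c) ≠ Sum.inr c) : σ (Sum.inr c) = Sum.inl u := by
      have hadj := adj_of_permWeight_ne_zero hσ hc
      rcases hx : σ (Sum.inr c) with a | c'
      · rw [hx] at hadj
        rw [attachPendants_adj_inl_inr.mp hadj]
      · rw [hx] at hadj
        exact absurd hadj attachPendants_adj_inr_inr
    have hu : σ (Sum.inl u) = Sum.inr b := by
      obtain ⟨x, hx⟩ := σ.surjective (Sum.inr b)
      have hne : σ x ≠ x := by
        rintro h
        rw [hx] at h
        exact hb (by rw [h, hx, h])
      have hadj := adj_of_permWeight_ne_zero hσ hne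
      rw [hx] at hadj
      obtain a | c := x
      · rw [← attachPendants_adj_inr_inl.mp hadj, hx]
      · exact absurd hadj attachPendants_adj_inr_inr
    have hb' := image hb
    obtain ⟨τ, hτ⟩ := lift (ρ := σ * Equiv.swap (Sum.inr b) (Sum.inl u)) fun c => by
      by_cases hc : c = b
      · simp [hc, hu]
      · rw [Equiv.Perm.mul_apply, Equiv.swap_apply_of_ne_of_ne (by simpa using hc) (by simp)]
        by_contra hne
        exact hc (Sum.inr_injective (σ.injective ((image hne).trans hb'.symm)))
    have hτu : τ u = u := by
      have h := congrArg (fun ρ : Equiv.Perm (α ⊕ β) => ρ (Sum.inl u)) hτ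
      simpa [hb'] using h
    refine ⟨Sum.inr (⟨τ, hτu⟩, b), ?_⟩
    simp [extendPerm, hτ, mul_assoc]

lemma lapRatio_attachPendants [Nonempty β] (hH : H.IsTree) :
    lapRatio (attachPendants β H u) =
      ∑ τ : Equiv.Perm α, permWeight (attachPendants β H u) (Equiv.Perm.sumCongr τ 1) +
        (∑ τ : {τ : Equiv.Perm α // τ u = u},
          permWeight (attachPendants β H u) (Equiv.Perm.sumCongr τ.1 1)) *
          ∑ b : β, (edgeDeg (attachPendants β H u) s(Sum.inl u, Sum.inr b))⁻¹ := by
  rw [lapRatio_attachPendants_eq_sum hH]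
  have hinj : Function.Injective (extendPerm u (id : β → β) fun _ => Sum.inl u) :=
    extendPerm_injective (fun _ => Or.inl rfl) (by simp) fun b b' h => by simpa using h
  rw [← Fintype.sum_of_injective _ hinj _ _
    (fun σ hσ => not_not.mp (mt mem_range_extendPerm_of_permWeight_ne_zero hσ)) fun _ => rfl,
    sum_permWeight_extendPerm (fun _ => Or.inl rfl) (by simp)]
  simp only [Sym2.eq_swap (a := Sum.inl u), id]

lemma le_lapRatio_joinTrees (hH : H.IsTree) (hT : T.IsTree) :
    ∑ τ : Equiv.Perm α, permWeight (joinTrees H T u v) (Equiv.Perm.sumCongr τ 1) +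
        (∑ τ : {τ : Equiv.Perm α // τ u = u},
          permWeight (joinTrees H T u v) (Equiv.Perm.sumCongr τ.1 1)) *
          ((edgeDeg (joinTrees H T u v) s(Sum.inl u, Sum.inr v))⁻¹ +
            ∑ᶠ e ∈ T.edgeSet, (edgeDeg (joinTrees H T u v) (e.map Sum.inr))⁻¹) ≤
      lapRatio (joinTrees H T u v) := by
  have ends (e : T.edgeSet) : ∃ p : β × β, s(p.1, p.2) = e.1 :=
    ⟨(Quot.out e.1), Quot.out_eq _⟩
  choose p hp using ends
  have hpadj (e : T.edgeSet) : T.Adj (p e).1 (p e).2 := by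
    rw [← SimpleGraph.mem_edgeSet, hp]
    exact e.2
  let b : Option T.edgeSet → β := fun o => o.elim v fun e => (p e).1
  let y : Option T.edgeSet → α ⊕ β := fun o => o.elim (Sum.inl u) fun e => Sum.inr (p e).2
  have hy (o) : y o = Sum.inl u ∨ ∃ c, y o = Sum.inr c := by
    cases o <;> simp [y]
  have hadj (o) : (joinTrees H T u v).Adj (Sum.inr (b o)) (y o) := by
    cases o with
    | none => simp [b, y]
    | some e => simpa [b, y] using hpadj e
  have hmap (e : T.edgeSet) :
      s(Sum.inr (b (some e)), y (some e)) = (e.1.map Sum.inr : Sym2 (α ⊕ β)) := by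
    rw [← hp e]
    rfl
  have hinj : Function.Injective fun o => s(Sum.inr (b o), y o) := by
    rintro (_ | e) (_ | e') h
    · rfl
    · simp [b, y] at h
    · simp [b, y] at h
    · dsimp only at h
      rw [hmap, hmap] at h
      rw [Subtype.ext (Sym2.map.injective Sum.inr_injective h)]
  have hsum : ∑ o, (edgeDeg (joinTrees H T u v) s(Sum.inr (b o), y o))⁻¹ =
      (edgeDeg (joinTrees H T u v) s(Sum.inl u, Sum.inr v))⁻¹ +
        ∑ᶠ e ∈ T.edgeSet, (edgeDeg (joinTrees H T u v) (e.map Sum.inr))⁻¹ := by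
    rw [Fintype.sum_option, ← finsum_set_coe_eq_finsum_mem, finsum_eq_sum_of_fintype]
    simp only [hmap]
    rw [Sym2.eq_swap (a := Sum.inl u)]
    rfl
  rw [← hsum, ← sum_permWeight_extendPerm hy hadj, lapRatio_joinTrees_eq_sum hH hT,
    ← Finset.sum_image (f := permWeight (joinTrees H T u v))
      (extendPerm_injective hy (fun o => (hadj o).ne) hinj).injOn]
  exact Finset.sum_le_univ_sum_of_nonneg fun σ => permWeight_nonneg σ

end Trees

/-- with `ψ` the sum of reciprocals of the edge degree products of the
edges of `T_r` together with `uv` in `G₁`, and `θ` the corresponding sum over the `r`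
pendant edges at `u` in `G₂`, if `ψ ≥ θ` then `π(G₁) ≥ π(G₂)`. -/
theorem lapRatio_joinTrees_ge_of_psi_ge_theta {α β : Type*} [Fintype α] [Fintype β]
    (r : ℕ) (hr : 1 ≤ r) (hβ : Fintype.card β = r)
    (H : SimpleGraph α) (T : SimpleGraph β) (hH : H.IsTree) (hT : T.IsTree)
    (u : α) (v : β)
    (hψθ : (∑ b : β, (edgeDeg (attachPendants β H u) s(Sum.inl u, Sum.inr b))⁻¹)
      ≤ (edgeDeg (joinTrees H T u v) s(Sum.inl u, Sum.inr v))⁻¹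
        + ∑ᶠ e ∈ T.edgeSet, (edgeDeg (joinTrees H T u v) (e.map Sum.inr))⁻¹) :
    lapRatio (attachPendants β H u) ≤ lapRatio (joinTrees H T u v) := by
  have : Nonempty β := ⟨v⟩
  refine le_trans ?_ (le_lapRatio_joinTrees hH hT)
  rw [lapRatio_attachPendants hH]
  refine add_le_add (Finset.sum_le_sum fun τ _ => permWeight_attachPendants_le hH hT τ)
    (mul_le_mul (Finset.sum_le_sum fun τ _ => permWeight_attachPendants_le hH hT τ.1) hψθ
      (Finset.sum_nonneg fun b _ => inv_nonneg.mpr (edgeDeg_nonneg _))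
      (Finset.sum_nonneg fun τ _ => permWeight_nonneg _))
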